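/- arXiv:2410.10598 — 4 statements merged into one kernel-verified Lean document; each statement's English description precedes it below -/
import Mathlib

section
/- Let n ≥ 2, and let φ : ℂ² → ℂ² be an invertible affine map, φ(x,y) = (ax+by+c, dx+ey+f) with a,b,c,d,e,f ∈ ℂ and ae − bd ≠ 0. Then φ commutes with the polynomial map B_n : ℂ² → ℂ² (i.e., φ ∘ B_n = B_n ∘ φ) if and only if φ is the identity map, or n is odd and φ(x,y) = (−x, y). Consequently the affine automorphism group of B_n is μ₂ (generated by (x,y) ↦ (−x,y)) when n is odd, and is trivial when n is even. -/
open MvPolynomial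

/-- The first coordinates `X_n ∈ ℂ[x,y]` of the folding maps `B_n = 𝖥_n[𝓑₂]`
(with `X 0 = x`, `X 1 = y`): `X_0 = 4`, `X_1 = x`, `X_2 = x²−2y−4`,
`X_3 = x³−3xy−3x`, and `X_{n+4} = x(X_{n+3}+X_{n+1}) − (2+y)X_{n+2} − X_n`. -/
noncomputable def XB : ℕ → MvPolynomial (Fin 2) ℂ
  | 0 => 4
  | 1 => X 0
  | 2 => X 0 ^ 2 - 2 * X 1 - 4
  | 3 => X 0 ^ 3 - 3 * X 0 * X 1 - 3 * X 0
  | n + 4 => X 0 * (XB (n + 3) + XB (n + 1)) - (2 + X 1) * XB (n + 2) - XB n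

/-- The second coordinates `Y_n ∈ ℂ[x,y]` of the folding maps `B_n = 𝖥_n[𝓑₂]`
(with `X 0 = x`, `X 1 = y`): `Y_0 = 4`, `Y_1 = y`, `Y_2 = y²−2x²+4y+4`,
`Y_3 = y³−3x²y+6y²+9y`, and `Y_{n+4} = y(Y_{n+3}+Y_{n+1}) − (x²−2y−2)Y_{n+2} − Y_n`. -/
noncomputable def YB : ℕ → MvPolynomial (Fin 2) ℂ
  | 0 => 4
  | 1 => X 1
  | 2 => X 1 ^ 2 - 2 * X 0 ^ 2 + 4 * X 1 + 4
  | 3 => X 1 ^ 3 - 3 * X 0 ^ 2 * X 1 + 6 * X 1 ^ 2 + 9 * X 1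
  | n + 4 => X 1 * (YB (n + 3) + YB (n + 1)) - (X 0 ^ 2 - 2 * X 1 - 2) * YB (n + 2) - YB n

/-- The `n`-th folding map `B_n = 𝖥_n[𝓑₂] : ℂ² → ℂ²`,
`B_n(x,y) = (X_n(x,y), Y_n(x,y))`. -/
noncomputable def Bmap (n : ℕ) : ℂ × ℂ → ℂ × ℂ :=
  fun p => (eval ![p.1, p.2] (XB n), eval ![p.1, p.2] (YB n))

/-- The homogenization `t ^ n * X_n (x / t, y / t)` of `X_n`, over any commutative ring. -/
def homX {R : Type*} [CommRing R] (x y t : R) : ℕ → R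
  | 0 => 4
  | 1 => x
  | 2 => x ^ 2 - 2 * y * t - 4 * t ^ 2
  | 3 => x ^ 3 - 3 * x * y * t - 3 * x * t ^ 2
  | n + 4 => x * (homX x y t (n + 3) + t ^ 2 * homX x y t (n + 1))
      - (2 * t ^ 2 + y * t) * homX x y t (n + 2) - t ^ 4 * homX x y t n

/-- The homogenization `t ^ n * Y_n (x / t, y / t)` of `Y_n`, over any commutative ring. -/
def homY {R : Type*} [CommRing R] (x y t : R) : ℕ → R
  | 0 => 4
  | 1 => y
  | 2 => y ^ 2 - 2 * x ^ 2 + 4 * y * t + 4 * t ^ 2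
  | 3 => y ^ 3 - 3 * x ^ 2 * y + 6 * y ^ 2 * t + 9 * y * t ^ 2
  | n + 4 => y * (homY x y t (n + 3) + t ^ 2 * homY x y t (n + 1))
      - (x ^ 2 - 2 * y * t - 2 * t ^ 2) * homY x y t (n + 2) - t ^ 4 * homY x y t n

section Hom

variable {R S : Type*} [CommRing R] [CommRing S]

theorem map_homX (g : R →+* S) (x y t : R) :
    ∀ n, g (homX x y t n) = homX (g x) (g y) (g t) n
  | 0 => by simp [homX, map_ofNat]
  | 1 => rfl
  | 2 => by simp [homX, map_ofNat]
  | 3 => by simp [homX, map_ofNat]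
  | n + 4 => by
    simp [homX, map_ofNat, map_homX g x y t n, map_homX g x y t (n + 1), map_homX g x y t (n + 2),
      map_homX g x y t (n + 3)]

theorem map_homY (g : R →+* S) (x y t : R) :
    ∀ n, g (homY x y t n) = homY (g x) (g y) (g t) n
  | 0 => by simp [homY, map_ofNat]
  | 1 => rfl
  | 2 => by simp [homY, map_ofNat]
  | 3 => by simp [homY, map_ofNat]
  | n + 4 => by
    simp [homY, map_ofNat, map_homY g x y t n, map_homY g x y t (n + 1), map_homY g x y t (n + 2),
      map_homY g x y t (n + 3)]

theorem homX_smul (l x y t : R) :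
    ∀ n, homX (l * x) (l * y) (l * t) n = l ^ n * homX x y t n
  | 0 => by simp [homX]
  | 1 => by simp [homX]
  | 2 => by simp only [homX]; ring
  | 3 => by simp only [homX]; ring
  | n + 4 => by
    simp only [homX, homX_smul l x y t n, homX_smul l x y t (n + 1), homX_smul l x y t (n + 2),
      homX_smul l x y t (n + 3)]
    ring

theorem homY_smul (l x y t : R) :
    ∀ n, homY (l * x) (l * y) (l * t) n = l ^ n * homY x y t n
  | 0 => by simp [homY]
  | 1 => by simp [homY]
  | 2 => by simp only [homY]; ring
  | 3 => by simp only [homY]; ring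
  | n + 4 => by
    simp only [homY, homY_smul l x y t n, homY_smul l x y t (n + 1), homY_smul l x y t (n + 2),
      homY_smul l x y t (n + 3)]
    ring

theorem homX_neg (x y t : R) : ∀ n, homX (-x) y t n = (-1) ^ n * homX x y t n
  | 0 => by simp [homX]
  | 1 => by simp [homX]
  | 2 => by simp only [homX]; ring
  | 3 => by simp only [homX]; ring
  | n + 4 => by
    simp only [homX, homX_neg x y t n, homX_neg x y t (n + 1), homX_neg x y t (n + 2),
      homX_neg x y t (n + 3)]
    ring

theorem homY_neg (x y t : R) : ∀ n, homY (-x) y t n = homY x y t n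
  | 0 => rfl
  | 1 => rfl
  | 2 => by simp only [homY]; ring
  | 3 => by simp only [homY]; ring
  | n + 4 => by
    simp only [homY, homY_neg x y t n, homY_neg x y t (n + 1), homY_neg x y t (n + 2),
      homY_neg x y t (n + 3)]
    ring

theorem homX_of_sq_eq_zero {t : R} (ht : t ^ 2 = 0) (x y : R) :
    ∀ n : ℕ, homX x y t (n + 2) = x ^ (n + 2) - (n + 2) * x ^ n * y * t
  | 0 => by simp [homX, ht]
  | 1 => by simp only [homX]; push_cast; linear_combination (-3 * x) * ht
  | n + 2 => by
    have h2 := homX_of_sq_eq_zero ht x y n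
    have h3 := homX_of_sq_eq_zero ht x y (n + 1)
    simp only [homX]
    push_cast at h3 ⊢
    linear_combination x * h3 - (2 * t ^ 2 + y * t) * h2 +
      (x * homX x y t (n + 1) - 2 * (x ^ (n + 2) - (n + 2) * x ^ n * y * t)
        + (n + 2) * x ^ n * y ^ 2 - t ^ 2 * homX x y t n) * ht

theorem homX_zero_right (x y : R) (n : ℕ) : homX x y 0 (n + 2) = x ^ (n + 2) := by
  simp [homX_of_sq_eq_zero (t := (0 : R)) (by simp)]

theorem homY_zero_left_of_sq_eq_zero {t : R} (ht : t ^ 2 = 0) (y : R) :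
    ∀ n : ℕ, homY 0 y t (n + 2) = y ^ (n + 2) + 2 * (n + 2) * y ^ (n + 1) * t
  | 0 => by simp only [homY]; push_cast; linear_combination 4 * ht
  | 1 => by simp only [homY]; push_cast; linear_combination (9 * y) * ht
  | n + 2 => by
    have h2 := homY_zero_left_of_sq_eq_zero ht y n
    have h3 := homY_zero_left_of_sq_eq_zero ht y (n + 1)
    simp only [homY]
    push_cast at h3 ⊢
    linear_combination y * h3 + (2 * t ^ 2 + 2 * y * t) * h2 +
      (y * homY 0 y t (n + 1) + 2 * (y ^ (n + 2) + 2 * (n + 2) * y ^ (n + 1) * t)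
        + 4 * (n + 2) * y ^ (n + 2) - t ^ 2 * homY 0 y t n) * ht

theorem add_mul_pow_of_sq_eq_zero {t : R} (ht : t ^ 2 = 0) (u v : R) (n : ℕ) :
    (u + v * t) ^ (n + 1) = u ^ (n + 1) + (n + 1) * u ^ n * v * t := by
  induction n with
  | zero => simp
  | succ n ih =>
    rw [pow_succ, ih]
    push_cast
    linear_combination ((n + 1) * u ^ n * v ^ 2) * ht

theorem exists_homY_zero_right_eq (x y : R) :
    ∀ n : ℕ, ∃ k, homY x y 0 (n + 2) = y ^ (n + 2) - (n + 2) * x ^ 2 * y ^ n + x ^ 3 * k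
  | 0 => ⟨0, by simp only [homY]; push_cast; ring⟩
  | 1 => ⟨0, by simp only [homY]; push_cast; ring⟩
  | n + 2 => by
    obtain ⟨k2, h2⟩ := exists_homY_zero_right_eq x y n
    obtain ⟨k3, h3⟩ := exists_homY_zero_right_eq x y (n + 1)
    refine ⟨y * k3 + (n + 2) * x * y ^ n - x ^ 2 * k2, ?_⟩
    simp only [homY]
    push_cast at h3 ⊢
    linear_combination y * h3 - x ^ 2 * h2

theorem homY_one_two_zero : ∀ n : ℕ, homY (1 : R) 2 0 (n + 1) = 2
  | 0 => rfl
  | 1 => by simp only [homY]; ring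
  | 2 => by simp only [homY]; ring
  | n + 3 => by
    simp only [homY, homY_one_two_zero (n + 1), homY_one_two_zero (n + 2)]
    ring

end Hom

theorem eval_XB (x y : ℂ) : ∀ n, eval ![x, y] (XB n) = homX x y 1 n
  | 0 => by simp [homX, XB]
  | 1 => by simp [homX, XB]
  | 2 => by simp [homX, XB]
  | 3 => by simp [homX, XB]
  | n + 4 => by
    simp [homX, XB, eval_XB x y n, eval_XB x y (n + 1), eval_XB x y (n + 2), eval_XB x y (n + 3)]

theorem eval_YB (x y : ℂ) : ∀ n, eval ![x, y] (YB n) = homY x y 1 n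
  | 0 => by simp [homY, YB]
  | 1 => by simp [homY, YB]
  | 2 => by simp [homY, YB]
  | 3 => by simp [homY, YB]
  | n + 4 => by
    simp [homY, YB, eval_YB x y n, eval_YB x y (n + 1), eval_YB x y (n + 2), eval_YB x y (n + 3)]

theorem Bmap_apply (n : ℕ) (p : ℂ × ℂ) : Bmap n p = (homX p.1 p.2 1 n, homY p.1 p.2 1 n) := by
  simp [Bmap, eval_XB, eval_YB]

theorem MvPolynomial.eq_of_eval_eq_of_ne_zero {P Q : MvPolynomial (Fin 3) ℂ}
    (h : ∀ v : Fin 3 → ℂ, v 2 ≠ 0 → eval v P = eval v Q) : P = Q := by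
  refine mul_left_cancel₀ (X_ne_zero (R := ℂ) (2 : Fin 3)) (MvPolynomial.funext fun v => ?_)
  by_cases hv : v 2 = 0
  · simp [hv]
  · simp [h v hv]

/-- If an affine map commutes with `B_n`, the homogenized identities hold in every commutative
`ℂ`-algebra. -/
theorem hom_identities_of_comm {n : ℕ} {a b c d e f : ℂ}
    (h : ((fun p : ℂ × ℂ => (a * p.1 + b * p.2 + c, d * p.1 + e * p.2 + f)) ∘ Bmap n
        = Bmap n ∘ (fun p : ℂ × ℂ => (a * p.1 + b * p.2 + c, d * p.1 + e * p.2 + f))))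
    {R : Type*} [CommRing R] [Algebra ℂ R] (x y t : R) :
    (algebraMap ℂ R a * homX x y t n + algebraMap ℂ R b * homY x y t n + algebraMap ℂ R c * t ^ n
      = homX (algebraMap ℂ R a * x + algebraMap ℂ R b * y + algebraMap ℂ R c * t)
          (algebraMap ℂ R d * x + algebraMap ℂ R e * y + algebraMap ℂ R f * t) t n) ∧
    (algebraMap ℂ R d * homX x y t n + algebraMap ℂ R e * homY x y t n + algebraMap ℂ R f * t ^ n
      = homY (algebraMap ℂ R a * x + algebraMap ℂ R b * y + algebraMap ℂ R c * t)
          (algebraMap ℂ R d * x + algebraMap ℂ R e * y + algebraMap ℂ R f * t) t n) := by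
  have key : ∀ u v w : ℂ, w ≠ 0 →
      (a * homX u v w n + b * homY u v w n + c * w ^ n
        = homX (a * u + b * v + c * w) (d * u + e * v + f * w) w n) ∧
      (d * homX u v w n + e * homY u v w n + f * w ^ n
        = homY (a * u + b * v + c * w) (d * u + e * v + f * w) w n) := by
    intro u v w hw
    have h1 := congrFun h (u / w, v / w)
    simp only [Function.comp_apply, Bmap_apply, Prod.mk.injEq] at h1
    have hu : u = w * (u / w) := by field_simp
    have hv : v = w * (v / w) := by field_simp
    have hX := homX_smul w (u / w) (v / w) 1 n
    have hY := homY_smul w (u / w) (v / w) 1 n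
    have hX' := homX_smul w (a * (u / w) + b * (v / w) + c) (d * (u / w) + e * (v / w) + f) 1 n
    have hY' := homY_smul w (a * (u / w) + b * (v / w) + c) (d * (u / w) + e * (v / w) + f) 1 n
    have e1 : w * (a * (u / w) + b * (v / w) + c) = a * u + b * v + c * w := by field_simp
    have e2 : w * (d * (u / w) + e * (v / w) + f) = d * u + e * v + f * w := by field_simp
    rw [← hu, ← hv, mul_one] at hX hY
    rw [e1, e2, mul_one] at hX' hY'
    rw [hX, hY, hX', hY', ← h1.1, ← h1.2]
    constructor <;> ring
  have p1 : C a * homX (X 0) (X 1) (X 2) n + C b * homY (X 0) (X 1) (X 2) n + C c * X 2 ^ n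
      = homX (C a * X 0 + C b * X 1 + C c * X 2)
          (C d * X 0 + C e * X 1 + C f * X 2 : MvPolynomial (Fin 3) ℂ) (X 2) n := by
    refine eq_of_eval_eq_of_ne_zero fun v hv => ?_
    simpa [map_homX, map_homY] using (key (v 0) (v 1) (v 2) hv).1
  have p2 : C d * homX (X 0) (X 1) (X 2) n + C e * homY (X 0) (X 1) (X 2) n + C f * X 2 ^ n
      = homY (C a * X 0 + C b * X 1 + C c * X 2)
          (C d * X 0 + C e * X 1 + C f * X 2 : MvPolynomial (Fin 3) ℂ) (X 2) n := by
    refine eq_of_eval_eq_of_ne_zero fun v hv => ?_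
    simpa [map_homX, map_homY] using (key (v 0) (v 1) (v 2) hv).2
  constructor
  · simpa [map_homX, map_homY, -coe_eval₂Hom] using
      congrArg (eval₂Hom (algebraMap ℂ R) ![x, y, t]) p1
  · simpa [map_homX, map_homY, -coe_eval₂Hom] using
      congrArg (eval₂Hom (algebraMap ℂ R) ![x, y, t]) p2

theorem DualNumber.eps_sq {K : Type*} [CommRing K] : (DualNumber.eps : DualNumber K) ^ 2 = 0 := by
  rw [pow_two, DualNumber.eps_mul_eps]

theorem DualNumber.eq_zero_of_algebraMap_mul_eps {K : Type*} [CommRing K] {u : K}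
    (h : algebraMap K (DualNumber K) u * DualNumber.eps = 0) : u = 0 := by
  simpa [TrivSqZeroExt.algebraMap_eq_inl] using congrArg TrivSqZeroExt.snd h

/-- An invertible affine map commuting with `B_n`, `n ≥ 2`, is of the form `(a x, y)` with
`a ^ 2 = 1` and `a ^ n = a`. -/
theorem coeff_eq_of_comm {m : ℕ} {a b c d e f : ℂ} (hinv : a * e - b * d ≠ 0)
    (h : ((fun p : ℂ × ℂ => (a * p.1 + b * p.2 + c, d * p.1 + e * p.2 + f)) ∘ Bmap (m + 2)
        = Bmap (m + 2) ∘
          (fun p : ℂ × ℂ => (a * p.1 + b * p.2 + c, d * p.1 + e * p.2 + f)))) :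
    a ^ 2 = 1 ∧ a ^ (m + 2) = a ∧ b = 0 ∧ c = 0 ∧ d = 0 ∧ e = 1 ∧ f = 0 := by
  have hm : ((m : ℂ) + 2) ≠ 0 := by exact_mod_cast (by omega : m + 2 ≠ 0)
  have htwo : (2 : ℂ) ^ (m + 2) ≠ 2 ∧ (2 : ℂ) ^ (m + 2) ≠ 0 := by
    refine ⟨?_, pow_ne_zero _ two_ne_zero⟩
    have : 2 ^ (m + 2) ≠ 2 := by
      have := Nat.one_le_two_pow (n := m)
      rw [pow_add]
      omega
    exact_mod_cast this
  have top : ∀ x y : ℂ, a * x ^ (m + 2) + b * homY x y 0 (m + 2) = (a * x + b * y) ^ (m + 2) := by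
    intro x y
    simpa [homX_zero_right] using (hom_identities_of_comm h x y 0).1
  have topb : b = b ^ (m + 2) := by
    simpa [homY_zero_left_of_sq_eq_zero (t := (0 : ℂ)) (by simp)] using top 0 1
  have hb : b = 0 := by
    by_contra hb
    have ha : a = 0 := by
      by_contra ha
      have e1 := top 1 (a / b)
      have e2 := top (-1) (a / b)
      have e3 := top 1 0
      have e4 := top (-1) 0
      rw [homY_neg] at e2 e4
      have hab : b * (a / b) = a := by field_simp
      rw [hab] at e1 e2
      have e5 : a ^ (m + 2) * (2 ^ (m + 2) - (1 - (-1) ^ (m + 2))) = 0 := by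
        have q1 : (a * 1 + a) ^ (m + 2) = a ^ (m + 2) * 2 ^ (m + 2) := by
          rw [← mul_pow]; ring
        have q2 : (a * -1 + a) ^ (m + 2) = 0 := by
          rw [show a * -1 + a = 0 by ring, zero_pow (by omega)]
        have q3 : (a * -1 + b * 0) ^ (m + 2) = a ^ (m + 2) * (-1) ^ (m + 2) := by
          rw [← mul_pow]; ring
        have q4 : (a * 1 + b * 0) ^ (m + 2) = a ^ (m + 2) := by ring
        rw [q1] at e1
        rw [q2] at e2
        rw [q3] at e4
        rw [q4] at e3
        linear_combination -e1 + e2 + e3 - e4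
      rcases mul_eq_zero.mp e5 with e6 | e6
      · exact ha (pow_eq_zero_iff (by omega) |>.mp e6)
      · rcases neg_one_pow_eq_or ℂ (m + 2) with h3 | h3 <;> rw [h3] at e6
        · exact htwo.2 (by linear_combination e6)
        · exact htwo.1 (by linear_combination e6)
    have e1 := top 1 2
    rw [homY_one_two_zero (m + 1), ha, zero_mul, zero_mul, zero_add, mul_pow,
      ← topb] at e1
    exact htwo.1 (mul_left_cancel₀ hb e1.symm)
  subst hb
  have ha : a ≠ 0 := by rintro rfl; simp at hinv
  have he : e ≠ 0 := by rintro rfl; simp at hinv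
  have han : a ^ (m + 2) = a := by simpa using (top 1 0).symm
  have han1 : a ^ (m + 1) = 1 := mul_right_cancel₀ ha (by linear_combination han)
  have hen : e ^ (m + 2) = e := by
    simpa [homX_zero_right, homY_zero_left_of_sq_eq_zero (t := (0 : ℂ)) (by simp)]
      using (hom_identities_of_comm h (0 : ℂ) 1 0).2.symm
  have hen1 : e ^ (m + 1) = 1 := mul_right_cancel₀ he (by linear_combination hen)
  set ι := algebraMap ℂ (DualNumber ℂ) with hι
  have heps := DualNumber.eps_sq (K := ℂ)
  have hιa : ι a ^ (m + 1) = 1 := by rw [← map_pow, han1, map_one]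
  have hιe : ι e ^ (m + 1) = 1 := by rw [← map_pow, hen1, map_one]
  have hιm : ι (m + 2) = m + 2 := by simp [map_ofNat]
  have hpow : (DualNumber.eps : DualNumber ℂ) ^ (m + 2) = 0 := by rw [pow_add, heps, mul_zero]
  have hd : d = 0 := by
    have e1 := (hom_identities_of_comm h (DualNumber.eps : DualNumber ℂ) 1 0).2
    rw [← hι] at e1
    have hx : (ι a * DualNumber.eps + ι 0 * 1 + ι c * 0) ^ 2 = 0 := by
      rw [map_zero]
      linear_combination ι a ^ 2 * heps
    obtain ⟨k, hk⟩ := exists_homY_zero_right_eq (DualNumber.eps : DualNumber ℂ) 1 m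
    obtain ⟨l, hl⟩ := exists_homY_zero_right_eq (ι a * DualNumber.eps + ι 0 * 1 + ι c * 0)
      (ι d * DualNumber.eps + ι e * 1 + ι f * 0) m
    rw [hk, hl, homX_zero_right, pow_succ _ 2, pow_succ _ 2, hx, heps, hpow,
      show ι d * DualNumber.eps + ι e * 1 + ι f * 0 = ι e + ι d * DualNumber.eps by ring,
      add_mul_pow_of_sq_eq_zero heps] at e1
    have e2 : ι ((m + 2) * d) * DualNumber.eps = 0 := by
      rw [map_mul, hιm]
      push_cast at e1
      simp only [one_pow, zero_pow (Nat.succ_ne_zero (m + 1))] at e1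
      linear_combination -e1 - (ι e + (m + 2) * ι d * DualNumber.eps) * hιe
    simpa [hm] using DualNumber.eq_zero_of_algebraMap_mul_eps e2
  subst hd
  have hc : c = 0 := by
    have e1 := (hom_identities_of_comm h 1 0 (DualNumber.eps : DualNumber ℂ)).1
    rw [← hι, homX_of_sq_eq_zero heps, homX_of_sq_eq_zero heps, hpow, map_zero,
      show ι a * 1 + 0 * 0 + ι c * DualNumber.eps = ι a + ι c * DualNumber.eps by ring,
      add_mul_pow_of_sq_eq_zero heps] at e1
    have e2 : ι ((m + 2) * c) * DualNumber.eps = 0 := by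
      rw [map_mul, hιm]
      push_cast at e1
      linear_combination -e1 - (ι a + (m + 2) * ι c * DualNumber.eps) * hιa
        + (m + 2) * (ι a + ι c * DualNumber.eps) ^ m * ι f * heps
    simpa [hm] using DualNumber.eq_zero_of_algebraMap_mul_eps e2
  subst hc
  have hea : a ^ 2 = e := by
    have e1 := (hom_identities_of_comm h 1 1 (DualNumber.eps : DualNumber ℂ)).1
    rw [← hι, homX_of_sq_eq_zero heps, homX_of_sq_eq_zero heps, hpow, map_zero,
      show ι a * 1 + 0 * 1 + 0 * DualNumber.eps = ι a by ring] at e1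
    have e2 : ι ((m + 2) * (a ^ 2 - e)) * DualNumber.eps = 0 := by
      simp only [map_mul, hιm, map_sub, map_pow]
      linear_combination -ι a * e1 - (ι a ^ 2 - (m + 2) * ι e * DualNumber.eps) * hιa
        + (m + 2) * ι a ^ (m + 1) * ι f * heps
    have := DualNumber.eq_zero_of_algebraMap_mul_eps e2
    exact sub_eq_zero.mp ((mul_eq_zero.mp this).resolve_left hm)
  have hf : f = 2 * (e - 1) := by
    have e1 := (hom_identities_of_comm h 0 1 (DualNumber.eps : DualNumber ℂ)).2
    rw [← hι, map_zero, homX_of_sq_eq_zero heps, hpow,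
      show ι a * 0 + 0 * 1 + 0 * DualNumber.eps = 0 by ring,
      homY_zero_left_of_sq_eq_zero heps, homY_zero_left_of_sq_eq_zero heps,
      show 0 * 0 + ι e * 1 + ι f * DualNumber.eps = ι e + ι f * DualNumber.eps by ring,
      add_mul_pow_of_sq_eq_zero heps, add_mul_pow_of_sq_eq_zero heps] at e1
    have e2 : ι ((m + 2) * (f - 2 * (e - 1))) * DualNumber.eps = 0 := by
      simp only [map_mul, hιm, map_sub, map_one, map_ofNat]
      push_cast at e1
      linear_combination -e1
        - (ι e + (m + 2) * ι f * DualNumber.eps + 2 * (m + 2) * DualNumber.eps) * hιe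
        - 2 * (m + 2) * (m + 1) * ι e ^ m * ι f * heps
    have := DualNumber.eq_zero_of_algebraMap_mul_eps e2
    exact sub_eq_zero.mp ((mul_eq_zero.mp this).resolve_left hm)
  have he1 : e = 1 := by
    have e1 := (hom_identities_of_comm h (Polynomial.X : Polynomial ℂ) 1 0).2
    obtain ⟨k, hk⟩ := exists_homY_zero_right_eq (Polynomial.X : Polynomial ℂ) 1 m
    obtain ⟨l, hl⟩ := exists_homY_zero_right_eq (Polynomial.C a * Polynomial.X)
      (Polynomial.C e) m
    simp only [Polynomial.algebraMap_eq, map_zero, zero_mul, mul_zero, mul_one, add_zero,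
      zero_add, hk, hl, zero_pow (Nat.succ_ne_zero (m + 1))] at e1
    have e2 : Polynomial.C (e ^ (m + 2) - e) + Polynomial.C ((m + 2) * (e - a ^ 2 * e ^ m))
        * Polynomial.X ^ 2
        + Polynomial.X ^ 3 * (Polynomial.C a ^ 3 * l - Polynomial.C e * k) = 0 := by
      simp only [map_sub, map_mul, map_add, map_pow, map_natCast, map_ofNat]
      simp only [one_pow] at e1
      linear_combination -e1
    have e3 := congrArg (fun p => Polynomial.coeff p 2) e2
    simp only [Polynomial.coeff_add, Polynomial.coeff_C_mul_X_pow, Polynomial.coeff_C,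
      Polynomial.coeff_X_pow_mul', Polynomial.coeff_zero] at e3
    norm_num at e3
    have e4 : e - a ^ 2 * e ^ m = 0 := e3.resolve_left hm
    rw [hea] at e4
    linear_combination e4 + hen1
  subst he1
  exact ⟨hea, han, rfl, rfl, rfl, rfl, by rw [hf]; ring⟩

/-- Let `n ≥ 2`.  An invertible affine map `φ(x,y) = (ax+by+c, dx+ey+f)` commutes
with the folding map `B_n` if and only if `φ` is the identity map, or `n` is odd and
`φ(x,y) = (−x, y)`.  Consequently `Aut(B_n) ≅ μ₂` for odd `n` and `Aut(B_n) = 1`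
for even `n`. -/
theorem Bmap_aut (n : ℕ) (hn : 2 ≤ n) (a b c d e f : ℂ) (hinv : a * e - b * d ≠ 0) :
    ((fun p : ℂ × ℂ => (a * p.1 + b * p.2 + c, d * p.1 + e * p.2 + f)) ∘ Bmap n
        = Bmap n ∘ (fun p : ℂ × ℂ => (a * p.1 + b * p.2 + c, d * p.1 + e * p.2 + f)))
      ↔ ((fun p : ℂ × ℂ => (a * p.1 + b * p.2 + c, d * p.1 + e * p.2 + f)) = id
          ∨ (Odd n ∧
              (fun p : ℂ × ℂ => (a * p.1 + b * p.2 + c, d * p.1 + e * p.2 + f))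
                = fun p : ℂ × ℂ => (-p.1, p.2))) := by
  constructor
  · intro h
    obtain ⟨m, rfl⟩ := Nat.exists_eq_add_of_le' hn
    obtain ⟨ha2, han, rfl, rfl, rfl, rfl, rfl⟩ := coeff_eq_of_comm hinv h
    rcases (sq_eq_sq_iff_eq_or_eq_neg.mp (ha2.trans (one_pow 2).symm)) with rfl | rfl
    · left
      funext p
      simp
    · right
      refine ⟨?_, by funext p; simp⟩
      by_contra hodd
      rw [(Nat.not_odd_iff_even.mp hodd).neg_one_pow] at han
      norm_num at han
  · rintro (h | ⟨hodd, h⟩)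
    · rw [h]
      rfl
    · rw [h]
      funext p
      simp [Bmap_apply, homX_neg, homY_neg, hodd.neg_one_pow]
end

section
/- Let n ≥ 2, and let φ : ℂ² → ℂ² be an invertible affine map, φ(x,y) = (ax+by+c, dx+ey+f) with a,b,c,d,e,f ∈ ℂ and ae − bd ≠ 0. If φ commutes with the polynomial map G_n : ℂ² → ℂ² (i.e., φ ∘ G_n = G_n ∘ φ), then φ is the identity map. That is, the affine automorphism group of the folding map G_n is trivial for all n ≥ 2. -/
open MvPolynomial

set_option maxHeartbeats 1000000

/-- The first coordinates `X_n ∈ ℂ[x,y]` of the folding maps `G_n = 𝖥_n[𝒢₂]`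
(with `X 0 = x`, `X 1 = y`), given by the initial values `X_0,…,X_5` and the recursion
`X_{n+6} = x(X_{n+5}+X_{n+1}) − (x+y+3)(X_{n+4}+X_{n+2}) + (x²−2y−4)X_{n+3} − X_n`. -/
noncomputable def XG : ℕ → MvPolynomial (Fin 2) ℂ
  | 0 => 6
  | 1 => X 0
  | 2 => X 0 ^ 2 - 2 * X 0 - 2 * X 1 - 6
  | 3 => X 0 ^ 3 - 3 * X 0 * X 1 - 9 * X 0 - 6 * X 1 - 12
  | 4 => X 0 ^ 4 - 4 * X 0 ^ 2 * X 1 - 10 * X 0 ^ 2 - 4 * X 0 * X 1 + 2 * X 1 ^ 2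
      - 8 * X 0 + 8 * X 1 + 6
  | 5 => X 0 ^ 5 - 5 * X 0 ^ 3 * X 1 - 15 * X 0 ^ 3 - 5 * X 0 ^ 2 * X 1
      + 5 * X 0 * X 1 ^ 2 - 10 * X 0 ^ 2 + 35 * X 0 * X 1 + 10 * X 1 ^ 2
      + 55 * X 0 + 50 * X 1 + 60
  | n + 6 => X 0 * (XG (n + 5) + XG (n + 1)) - (X 0 + X 1 + 3) * (XG (n + 4) + XG (n + 2))
      + (X 0 ^ 2 - 2 * X 1 - 4) * XG (n + 3) - XG n

/-- The second coordinates `Y_n ∈ ℂ[x,y]` of the folding maps `G_n = 𝖥_n[𝒢₂]`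
(with `X 0 = x`, `X 1 = y`), given by the initial values `Y_0,…,Y_5` and the recursion
`Y_{n+6} = y(Y_{n+5}+Y_{n+1}) − (x³−3xy−9x−5y−9)(Y_{n+4}+Y_{n+2})
+ (y²−2x³+6xy+18x+12y+8)Y_{n+3} − Y_n`. -/
noncomputable def YG : ℕ → MvPolynomial (Fin 2) ℂ
  | 0 => 6
  | 1 => X 1
  | 2 => -2 * X 0 ^ 3 + 6 * X 0 * X 1 + X 1 ^ 2 + 18 * X 0 + 10 * X 1 + 18
  | 3 => -3 * X 0 ^ 3 * X 1 - 6 * X 0 ^ 3 + 9 * X 0 * X 1 ^ 2 + X 1 ^ 3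
      + 45 * X 0 * X 1 + 18 * X 1 ^ 2 + 54 * X 0 + 63 * X 1 + 60
  | 4 => 2 * X 0 ^ 6 - 12 * X 0 ^ 4 * X 1 - 4 * X 0 ^ 3 * X 1 ^ 2 - 36 * X 0 ^ 4
      - 28 * X 0 ^ 3 * X 1 + 18 * X 0 ^ 2 * X 1 ^ 2 + 12 * X 0 * X 1 ^ 3 + X 1 ^ 4
      - 40 * X 0 ^ 3 + 108 * X 0 ^ 2 * X 1 + 120 * X 0 * X 1 ^ 2 + 24 * X 1 ^ 3
      + 162 * X 0 ^ 2 + 372 * X 0 * X 1 + 134 * X 1 ^ 2 + 360 * X 0 + 280 * X 1 + 198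
  | 5 => 5 * X 0 ^ 6 * X 1 + 10 * X 0 ^ 6 - 30 * X 0 ^ 4 * X 1 ^ 2 - 5 * X 0 ^ 3 * X 1 ^ 3
      - 150 * X 0 ^ 4 * X 1 - 65 * X 0 ^ 3 * X 1 ^ 2 + 45 * X 0 ^ 2 * X 1 ^ 3
      + 15 * X 0 * X 1 ^ 4 + X 1 ^ 5 - 180 * X 0 ^ 4 - 205 * X 0 ^ 3 * X 1
      + 360 * X 0 ^ 2 * X 1 ^ 2 + 240 * X 0 * X 1 ^ 3 + 30 * X 1 ^ 4 - 190 * X 0 ^ 3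
      + 945 * X 0 ^ 2 * X 1 + 1200 * X 0 * X 1 ^ 2 + 255 * X 1 ^ 3 + 810 * X 0 ^ 2
      + 2415 * X 0 * X 1 + 920 * X 1 ^ 2 + 1710 * X 0 + 1495 * X 1 + 900
  | n + 6 => X 1 * (YG (n + 5) + YG (n + 1))
      - (X 0 ^ 3 - 3 * X 0 * X 1 - 9 * X 0 - 5 * X 1 - 9) * (YG (n + 4) + YG (n + 2))
      + (X 1 ^ 2 - 2 * X 0 ^ 3 + 6 * X 0 * X 1 + 18 * X 0 + 12 * X 1 + 8) * YG (n + 3)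
      - YG n

/-- The `n`-th folding map `G_n = 𝖥_n[𝒢₂] : ℂ² → ℂ²`,
`G_n(x,y) = (X_n(x,y), Y_n(x,y))`. -/
noncomputable def Gmap (n : ℕ) : ℂ × ℂ → ℂ × ℂ :=
  fun p => (eval ![p.1, p.2] (XG n), eval ![p.1, p.2] (YG n))

/-- The rescaled values `δ ^ n * X_n(x / δ, y / δ)` are polynomial in `δ`, and known modulo
`δ ^ 2`. -/
theorem exists_XG_homogenization (δ x y : Polynomial ℂ) : ∀ n : ℕ, ∃ h : Polynomial ℂ,
    (∀ z : ℂ, δ.eval z ≠ 0 → h.eval z =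
      δ.eval z ^ n * eval ![x.eval z / δ.eval z, y.eval z / δ.eval z] (XG n)) ∧
    (2 ≤ n → δ ^ 2 ∣
      h - (x ^ n - n * δ * x ^ (n - 2) * y - if n = 2 then 2 * δ * x else 0))
  | 0 => ⟨6, fun z hz => by simp [XG], by simp⟩
  | 1 => ⟨x, fun z hz => by simp [XG]; field_simp, by simp⟩
  | 2 => ⟨x ^ 2 - 2 * δ * x - 2 * δ * y - 6 * δ ^ 2,
      fun z hz => by simp [XG]; field_simp, fun _ => ⟨-6, by simp; ring⟩⟩
  | 3 => ⟨x ^ 3 - 3 * δ * x * y + δ ^ 2 * (-9 * x - 6 * y - 12 * δ),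
      fun z hz => by simp [XG]; field_simp; ring,
      fun _ => ⟨-9 * x - 6 * y - 12 * δ, by simp⟩⟩
  | 4 => ⟨x ^ 4 - 4 * δ * x ^ 2 * y
        + δ ^ 2 * (-10 * x ^ 2 - 4 * x * y - 8 * x * δ + 2 * y ^ 2 + 8 * y * δ + 6 * δ ^ 2),
      fun z hz => by simp [XG]; field_simp; ring,
      fun _ => ⟨-10 * x ^ 2 - 4 * x * y - 8 * x * δ + 2 * y ^ 2 + 8 * y * δ + 6 * δ ^ 2, by simp⟩⟩
  | 5 => ⟨x ^ 5 - 5 * δ * x ^ 3 * y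
        + δ ^ 2 * (-15 * x ^ 3 - 5 * x ^ 2 * y - 10 * x ^ 2 * δ + 5 * x * y ^ 2 + 35 * x * y * δ
        + 55 * x * δ ^ 2
          + 10 * y ^ 2 * δ + 50 * y * δ ^ 2 + 60 * δ ^ 3),
      fun z hz => by simp [XG]; field_simp; ring,
      fun _ => ⟨-15 * x ^ 3 - 5 * x ^ 2 * y - 10 * x ^ 2 * δ + 5 * x * y ^ 2 + 35 * x * y * δ
          + 55 * x * δ ^ 2
          + 10 * y ^ 2 * δ + 50 * y * δ ^ 2 + 60 * δ ^ 3, by simp⟩⟩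
  | n + 6 => by
    obtain ⟨h₀, e₀, -⟩ := exists_XG_homogenization δ x y n
    obtain ⟨h₁, e₁, -⟩ := exists_XG_homogenization δ x y (n + 1)
    obtain ⟨h₂, e₂, -⟩ := exists_XG_homogenization δ x y (n + 2)
    obtain ⟨h₃, e₃, d₃⟩ := exists_XG_homogenization δ x y (n + 3)
    obtain ⟨h₄, e₄, d₄⟩ := exists_XG_homogenization δ x y (n + 4)
    obtain ⟨h₅, e₅, d₅⟩ := exists_XG_homogenization δ x y (n + 5)
    obtain ⟨g₃, d₃⟩ := d₃ (by omega)
    obtain ⟨g₄, d₄⟩ := d₄ (by omega)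
    obtain ⟨g₅, d₅⟩ := d₅ (by omega)
    refine ⟨x * (h₅ + δ ^ 4 * h₁) - δ * (x + y + 3 * δ) * (h₄ + δ ^ 2 * h₂)
      + δ * (x ^ 2 - 2 * δ * y - 4 * δ ^ 2) * h₃ - δ ^ 6 * h₀, fun z hz => ?_, fun _ => ?_⟩
    · simp [XG, e₀ z hz, e₁ z hz, e₂ z hz, e₃ z hz, e₄ z hz, e₅ z hz]
      field_simp
      ring
    · simp only [Nat.reduceEqDiff, if_false, sub_zero,
        show n + 3 - 2 = n + 1 by omega, show n + 4 - 2 = n + 2 by omega,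
        show n + 5 - 2 = n + 3 by omega, show n + 6 - 2 = n + 4 by omega] at d₃ d₄ d₅ ⊢
      rw [sub_eq_iff_eq_add] at d₃ d₄ d₅
      refine ⟨x * (g₅ + δ ^ 2 * h₁) - 3 * h₄ - δ * (x + y) * g₄ - δ * (x + y + 3 * δ) * h₂
        + (n + 4) * (x + y) * x ^ (n + 2) * y + δ * (x ^ 2 - 2 * δ * y - 4 * δ ^ 2) * g₃
        - (2 * y + 4 * δ) * x ^ (n + 3)
        - (n + 3) * (x ^ 2 - 2 * δ * y - 4 * δ ^ 2) * x ^ (n + 1) * y - δ ^ 4 * h₀, ?_⟩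
      rw [d₃, d₄, d₅]
      push_cast
      ring

/-- The rescaled values `δ ^ (2 * n) * Y_n(x / δ, y / δ ^ 2)` are polynomial in `δ`, and known
modulo `δ ^ 2`. -/
theorem exists_YG_homogenization (δ x y : Polynomial ℂ) : ∀ n : ℕ, ∃ h : Polynomial ℂ,
    (∀ z : ℂ, δ.eval z ≠ 0 → h.eval z =
      δ.eval z ^ (2 * n) * eval ![x.eval z / δ.eval z, y.eval z / δ.eval z ^ 2] (YG n)) ∧
    (2 ≤ n → δ ^ 2 ∣
      h - (y ^ n + n * δ * (3 * x * y ^ (n - 1) - x ^ 3 * y ^ (n - 2))))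
  | 0 => ⟨6, fun z hz => by simp [YG], by simp⟩
  | 1 => ⟨y, fun z hz => by simp [YG]; field_simp, by simp⟩
  | 2 => ⟨y ^ 2 + 2 * δ * (3 * x * y - x ^ 3) + δ ^ 2 * (18 * x * δ + 10 * y + 18 * δ ^ 2),
      fun z hz => by simp [YG]; field_simp; ring,
      fun _ => ⟨18 * x * δ + 10 * y + 18 * δ ^ 2, by simp⟩⟩
  | 3 => ⟨y ^ 3 + 3 * δ * (3 * x * y ^ 2 - x ^ 3 * y) + δ ^ 2 * (-6 * x ^ 3 * δ + 45 * x * y * δ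
      + 54 * x * δ ^ 3 + 18 * y ^ 2 + 63 * y * δ ^ 2 + 60 * δ ^ 4),
      fun z hz => by simp [YG]; field_simp; ring,
      fun _ => ⟨-6 * x ^ 3 * δ + 45 * x * y * δ + 54 * x * δ ^ 3 + 18 * y ^ 2 + 63 * y * δ ^ 2
          + 60 * δ ^ 4, by simp⟩⟩
  | 4 => ⟨y ^ 4 + 4 * δ * (3 * x * y ^ 3 - x ^ 3 * y ^ 2) + δ ^ 2 * (2 * x ^ 6 - 12 * x ^ 4 * y
      - 36 * x ^ 4 * δ ^ 2 - 28 * x ^ 3 * y * δ - 40 * x ^ 3 * δ ^ 3 + 18 * x ^ 2 * y ^ 2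
      + 108 * x ^ 2 * y * δ ^ 2
        + 162 * x ^ 2 * δ ^ 4 + 120 * x * y ^ 2 * δ + 372 * x * y * δ ^ 3 + 360 * x * δ ^ 5
        + 24 * y ^ 3 + 134 * y ^ 2 * δ ^ 2
        + 280 * y * δ ^ 4 + 198 * δ ^ 6),
      fun z hz => by simp [YG]; field_simp; ring,
      fun _ => ⟨2 * x ^ 6 - 12 * x ^ 4 * y - 36 * x ^ 4 * δ ^ 2 - 28 * x ^ 3 * y * δ
          - 40 * x ^ 3 * δ ^ 3 + 18 * x ^ 2 * y ^ 2 + 108 * x ^ 2 * y * δ ^ 2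
        + 162 * x ^ 2 * δ ^ 4 + 120 * x * y ^ 2 * δ + 372 * x * y * δ ^ 3 + 360 * x * δ ^ 5
        + 24 * y ^ 3 + 134 * y ^ 2 * δ ^ 2
        + 280 * y * δ ^ 4 + 198 * δ ^ 6, by simp⟩⟩
  | 5 => ⟨y ^ 5 + 5 * δ * (3 * x * y ^ 4 - x ^ 3 * y ^ 3) + δ ^ 2 * (5 * x ^ 6 * y
      + 10 * x ^ 6 * δ ^ 2 - 30 * x ^ 4 * y ^ 2 - 150 * x ^ 4 * y * δ ^ 2 - 180 * x ^ 4 * δ ^ 4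
      - 65 * x ^ 3 * y ^ 2 * δ
        - 205 * x ^ 3 * y * δ ^ 3 - 190 * x ^ 3 * δ ^ 5 + 45 * x ^ 2 * y ^ 3
        + 360 * x ^ 2 * y ^ 2 * δ ^ 2 + 945 * x ^ 2 * y * δ ^ 4
        + 810 * x ^ 2 * δ ^ 6 + 240 * x * y ^ 3 * δ + 1200 * x * y ^ 2 * δ ^ 3
        + 2415 * x * y * δ ^ 5 + 1710 * x * δ ^ 7 + 30 * y ^ 4
        + 255 * y ^ 3 * δ ^ 2 + 920 * y ^ 2 * δ ^ 4 + 1495 * y * δ ^ 6 + 900 * δ ^ 8),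
      fun z hz => by simp [YG]; field_simp; ring,
      fun _ => ⟨5 * x ^ 6 * y + 10 * x ^ 6 * δ ^ 2 - 30 * x ^ 4 * y ^ 2 - 150 * x ^ 4 * y * δ ^ 2
          - 180 * x ^ 4 * δ ^ 4 - 65 * x ^ 3 * y ^ 2 * δ
        - 205 * x ^ 3 * y * δ ^ 3 - 190 * x ^ 3 * δ ^ 5 + 45 * x ^ 2 * y ^ 3
        + 360 * x ^ 2 * y ^ 2 * δ ^ 2 + 945 * x ^ 2 * y * δ ^ 4
        + 810 * x ^ 2 * δ ^ 6 + 240 * x * y ^ 3 * δ + 1200 * x * y ^ 2 * δ ^ 3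
        + 2415 * x * y * δ ^ 5 + 1710 * x * δ ^ 7 + 30 * y ^ 4
        + 255 * y ^ 3 * δ ^ 2 + 920 * y ^ 2 * δ ^ 4 + 1495 * y * δ ^ 6 + 900 * δ ^ 8, by simp⟩⟩
  | n + 6 => by
    obtain ⟨h₀, e₀, -⟩ := exists_YG_homogenization δ x y n
    obtain ⟨h₁, e₁, -⟩ := exists_YG_homogenization δ x y (n + 1)
    obtain ⟨h₂, e₂, -⟩ := exists_YG_homogenization δ x y (n + 2)
    obtain ⟨h₃, e₃, -⟩ := exists_YG_homogenization δ x y (n + 3)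
    obtain ⟨h₄, e₄, d₄⟩ := exists_YG_homogenization δ x y (n + 4)
    obtain ⟨h₅, e₅, d₅⟩ := exists_YG_homogenization δ x y (n + 5)
    obtain ⟨g₄, d₄⟩ := d₄ (by omega)
    obtain ⟨g₅, d₅⟩ := d₅ (by omega)
    refine ⟨y * (h₅ + δ ^ 8 * h₁)
      - δ * (x ^ 3 - 3 * x * y - 9 * x * δ ^ 2 - 5 * y * δ - 9 * δ ^ 3) * (h₄ + δ ^ 4 * h₂)
      + δ ^ 2 * (y ^ 2 - 2 * x ^ 3 * δ + 6 * x * y * δ + 18 * x * δ ^ 3 + 12 * y * δ ^ 2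
        + 8 * δ ^ 4) * h₃ - δ ^ 12 * h₀, fun z hz => ?_, fun _ => ?_⟩
    · simp [YG, e₀ z hz, e₁ z hz, e₂ z hz, e₃ z hz, e₄ z hz, e₅ z hz]
      field_simp
      ring
    · simp only [show n + 4 - 2 = n + 2 by omega, show n + 4 - 1 = n + 3 by omega,
        show n + 5 - 2 = n + 3 by omega, show n + 5 - 1 = n + 4 by omega,
        show n + 6 - 2 = n + 4 by omega, show n + 6 - 1 = n + 5 by omega] at d₄ d₅ ⊢
      rw [sub_eq_iff_eq_add] at d₄ d₅
      refine ⟨y * (g₅ + δ ^ 6 * h₁) - δ * (x ^ 3 - 3 * x * y) * (g₄ + δ ^ 2 * h₂)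
        - (n + 4) * (x ^ 3 - 3 * x * y) * (3 * x * y ^ (n + 3) - x ^ 3 * y ^ (n + 2))
        + (9 * x * δ + 5 * y + 9 * δ ^ 2) * (h₄ + δ ^ 4 * h₂)
        + (y ^ 2 - 2 * x ^ 3 * δ + 6 * x * y * δ + 18 * x * δ ^ 3 + 12 * y * δ ^ 2
          + 8 * δ ^ 4) * h₃ - δ ^ 10 * h₀, ?_⟩
      rw [d₄, d₅]
      push_cast
      ring

theorem eval_zero_eq_of_X_sq_dvd_sub {p q : Polynomial ℂ} (h : Polynomial.X ^ 2 ∣ p - q) :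
    p.eval 0 = q.eval 0 ∧ p.derivative.eval 0 = q.derivative.eval 0 := by
  obtain ⟨g, hg⟩ := h
  rw [sub_eq_iff_eq_add] at hg
  simp [hg]

theorem Polynomial.eq_of_eval_eq_of_ne_zero {p q : Polynomial ℂ}
    (h : ∀ z : ℂ, z ≠ 0 → p.eval z = q.eval z) : p = q :=
  Polynomial.eq_of_infinite_eval_eq p q
    ((Set.finite_singleton (0 : ℂ)).infinite_compl.mono fun z hz => h z hz)

section Equivariance

variable {m : ℕ} {a b c d e f : ℂ}

/-- If the first coordinate of an affine map is equivariant for `G_n`, it does not involve `y`. -/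
theorem XG_equivariant_coeff_eq_zero
    (hX : ∀ x y : ℂ, a * eval ![x, y] (XG (m + 2)) + b * eval ![x, y] (YG (m + 2)) + c
      = eval ![a * x + b * y + c, d * x + e * y + f] (XG (m + 2))) : b = 0 := by
  have key (s : ℂ) : b * ((m + 2) * (3 * s - s ^ 3)) = (m + 2) * b ^ (m + 1) * (a * s) := by
    obtain ⟨h₁, e₁, d₁⟩ := exists_XG_homogenization (Polynomial.X ^ 2)
      (Polynomial.X * Polynomial.C s) 1 (m + 2)
    obtain ⟨h₂, e₂, d₂⟩ := exists_YG_homogenization Polynomial.X (Polynomial.C s) 1 (m + 2)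
    obtain ⟨h₃, e₃, d₃⟩ := exists_XG_homogenization (Polynomial.X ^ 2)
      (Polynomial.C b + Polynomial.C (a * s) * Polynomial.X + Polynomial.C c * Polynomial.X ^ 2)
        (Polynomial.C e + Polynomial.C (d * s) * Polynomial.X + Polynomial.C f * Polynomial.X ^ 2)
          (m + 2)
    have h : Polynomial.C a * h₁ + Polynomial.C b * h₂ + Polynomial.C c *
      Polynomial.X ^ (2 * (m + 2)) = h₃ := by
      refine Polynomial.eq_of_eval_eq_of_ne_zero fun z hz => ?_
      have hz' : (Polynomial.X ^ 2 : Polynomial ℂ).eval z ≠ 0 := by simpa using hz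
      simp only [Polynomial.eval_add, Polynomial.eval_mul, Polynomial.eval_C, Polynomial.eval_pow,
        Polynomial.eval_X, e₁ z hz', e₂ z (by simpa), e₃ z hz',
        Polynomial.eval_one]
      have hs := hX (s / z) (1 / z ^ 2)
      rw [show (b + a * s * z + c * z ^ 2) / z ^ 2 = a * (s / z) + b * (1 / z ^ 2) + c by
          field_simp; ring,
        show (e + d * s * z + f * z ^ 2) / z ^ 2 = d * (s / z) + e * (1 / z ^ 2) + f by
          field_simp; ring,
        show z * s / z ^ 2 = s / z by field_simp, ← hs]
      ring
    have h2 : (Polynomial.X ^ 2 : Polynomial ℂ) ∣ (Polynomial.X ^ 2) ^ 2 :=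
      dvd_pow_self _ two_ne_zero
    have h₁' := (eval_zero_eq_of_X_sq_dvd_sub (h2.trans (d₁ (by omega)))).2
    have h₂' := (eval_zero_eq_of_X_sq_dvd_sub (d₂ (by omega))).2
    have h₃' := (eval_zero_eq_of_X_sq_dvd_sub (h2.trans (d₃ (by omega)))).2
    have h' := congrArg (fun p => p.derivative.eval 0) h
    simp [apply_ite Polynomial.derivative, apply_ite (Polynomial.eval (0 : ℂ)),
      Polynomial.derivative_pow, h₁', h₂', h₃',
      show 2 * (m + 2) - 1 ≠ 0 by omega] at h'
    linear_combination h'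
  have hm : (m + 2 : ℂ) ≠ 0 := by exact_mod_cast (m + 1).succ_ne_zero
  have : (m + 2 : ℂ) * b = 0 := by linear_combination (key 1 * 2 - key 2) / 6
  exact (mul_eq_zero.1 this).resolve_left hm

theorem XG_equivariant_coeff_relations
    (hX : ∀ x y : ℂ, a * eval ![x, y] (XG (m + 2)) + c
      = eval ![a * x + c, d * x + e * y + f] (XG (m + 2))) :
    a = a ^ (m + 2) ∧ a = a ^ m * e ∧
      a ^ (m + 1) * c * (m + 2) = (m + 2) * a ^ m * d := by
  have key (s : ℂ) : a = a ^ (m + 2) ∧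
      -(m + 2) * a * s = (m + 2) * a ^ (m + 1) * c - (m + 2) * a ^ m * (d + e * s) := by
    obtain ⟨h₁, e₁, d₁⟩ := exists_XG_homogenization Polynomial.X 1 (Polynomial.C s) (m + 2)
    obtain ⟨h₃, e₃, d₃⟩ := exists_XG_homogenization Polynomial.X
      (Polynomial.C a + Polynomial.C c * Polynomial.X)
      (Polynomial.C (d + e * s) + Polynomial.C f * Polynomial.X) (m + 2)
    have h : Polynomial.C a * h₁ + Polynomial.C c * Polynomial.X ^ (m + 2) = h₃ := by
      refine Polynomial.eq_of_eval_eq_of_ne_zero fun z hz => ?_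
      have hz' : (Polynomial.X : Polynomial ℂ).eval z ≠ 0 := by simpa using hz
      simp only [Polynomial.eval_add, Polynomial.eval_mul, Polynomial.eval_C, Polynomial.eval_pow,
        Polynomial.eval_X, e₁ z hz', e₃ z hz', Polynomial.eval_one]
      have hs := hX (1 / z) (s / z)
      rw [show (a + c * z) / z = a * (1 / z) + c by field_simp,
        show (d + e * s + f * z) / z = d * (1 / z) + e * (s / z) + f by field_simp, ← hs]
      ring
    obtain ⟨h₁', h₁''⟩ := eval_zero_eq_of_X_sq_dvd_sub (d₁ (by omega))
    obtain ⟨h₃', h₃''⟩ := eval_zero_eq_of_X_sq_dvd_sub (d₃ (by omega))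
    have h' := congrArg (fun p => p.eval 0) h
    have h'' := congrArg (fun p => p.derivative.eval 0) h
    simp [apply_ite (Polynomial.eval (0 : ℂ)), h₁', h₃'] at h'
    simp [apply_ite Polynomial.derivative, apply_ite (Polynomial.eval (0 : ℂ)),
      Polynomial.derivative_pow, h₁'', h₃''] at h''
    refine ⟨h', ?_⟩
    split_ifs at h'' <;> linear_combination h''
  have hm : (m + 2 : ℂ) ≠ 0 := by exact_mod_cast (m + 1).succ_ne_zero
  refine ⟨(key 0).1, mul_left_cancel₀ hm ?_, ?_⟩
  · linear_combination (key 0).2 - (key 1).2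
  · linear_combination - (key 0).2

theorem YG_equivariant_coeff_relations
    (hY : ∀ x y : ℂ, d * eval ![x, y] (XG (m + 2)) + e * eval ![x, y] (YG (m + 2)) + f
      = eval ![a * x + c, d * x + e * y + f] (YG (m + 2))) :
    e = e ^ (m + 2) ∧ e = a ^ 3 * e ^ m ∧ 3 * e = e ^ (m + 1) * (d + 3 * a) := by
  have key (s : ℂ) : e = e ^ (m + 2) ∧ e * ((m + 2) * (3 * s - s ^ 3)) =
      (m + 2) * e ^ (m + 1) * (d * s)
        + (m + 2) * (3 * (a * s) * e ^ (m + 1) - (a * s) ^ 3 * e ^ m) := by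
    obtain ⟨h₁, e₁, d₁⟩ := exists_XG_homogenization (Polynomial.X ^ 2)
      (Polynomial.X * Polynomial.C s) 1 (m + 2)
    obtain ⟨h₂, e₂, d₂⟩ := exists_YG_homogenization Polynomial.X (Polynomial.C s) 1 (m + 2)
    obtain ⟨h₃, e₃, d₃⟩ := exists_YG_homogenization Polynomial.X
      (Polynomial.C (a * s) + Polynomial.C c * Polynomial.X)
      (Polynomial.C e + Polynomial.C (d * s) * Polynomial.X + Polynomial.C f * Polynomial.X ^ 2)
      (m + 2)
    have h : Polynomial.C d * h₁ + Polynomial.C e * h₂ + Polynomial.C f *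
      Polynomial.X ^ (2 * (m + 2)) = h₃ := by
      refine Polynomial.eq_of_eval_eq_of_ne_zero fun z hz => ?_
      have hz' : (Polynomial.X ^ 2 : Polynomial ℂ).eval z ≠ 0 := by simpa using hz
      simp only [Polynomial.eval_add, Polynomial.eval_mul, Polynomial.eval_C, Polynomial.eval_pow,
        Polynomial.eval_X, e₁ z hz', e₂ z (by simpa),
        e₃ z (by simpa), Polynomial.eval_one]
      have hs := hY (s / z) (1 / z ^ 2)
      rw [show (a * s + c * z) / z = a * (s / z) + c by field_simp,
        show (e + d * s * z + f * z ^ 2) / z ^ 2 = d * (s / z) + e * (1 / z ^ 2) + f by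
          field_simp; ring,
        show z * s / z ^ 2 = s / z by field_simp, ← hs]
      ring
    have h2 : (Polynomial.X ^ 2 : Polynomial ℂ) ∣ (Polynomial.X ^ 2) ^ 2 :=
      dvd_pow_self _ two_ne_zero
    obtain ⟨h₁', h₁''⟩ := eval_zero_eq_of_X_sq_dvd_sub (h2.trans (d₁ (by omega)))
    obtain ⟨h₂', h₂''⟩ := eval_zero_eq_of_X_sq_dvd_sub (d₂ (by omega))
    obtain ⟨h₃', h₃''⟩ := eval_zero_eq_of_X_sq_dvd_sub (d₃ (by omega))
    have h' := congrArg (fun p => p.eval 0) h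
    have h'' := congrArg (fun p => p.derivative.eval 0) h
    simp [apply_ite (Polynomial.eval (0 : ℂ)), h₁', h₂', h₃'] at h'
    simp [apply_ite Polynomial.derivative, apply_ite (Polynomial.eval (0 : ℂ)),
      Polynomial.derivative_pow, h₁'', h₂'',
      h₃'', show 2 * (m + 2) - 1 ≠ 0 by omega] at h''
    exact ⟨h', by linear_combination h''⟩
  have hm : (m + 2 : ℂ) ≠ 0 := by exact_mod_cast (m + 1).succ_ne_zero
  refine ⟨(key 0).1, mul_left_cancel₀ hm ?_, mul_left_cancel₀ hm ?_⟩
  · linear_combination ((key 1).2 * 2 - (key 2).2) / 6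
  · linear_combination ((key 1).2 * 8 - (key 2).2) / 6

/-- The polynomial `X_n` has no nontrivial period in the second variable. -/
theorem eq_zero_of_XG_periodic
    (hX : ∀ x y : ℂ, eval ![x, y] (XG (m + 2)) = eval ![x, y + f] (XG (m + 2))) : f = 0 := by
  have hk (k : ℕ) (x : ℂ) : eval ![x, 0] (XG (m + 2)) = eval ![x, k * f] (XG (m + 2)) := by
    induction k with
    | zero => simp
    | succ k ih => rw [ih, hX]; push_cast; ring_nf
  obtain ⟨h₁, e₁, d₁⟩ := exists_XG_homogenization Polynomial.X 1 0 (m + 2)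
  obtain ⟨h₂, e₂, d₂⟩ := exists_XG_homogenization Polynomial.X 1 (Polynomial.C f) (m + 2)
  have h : h₁ = h₂ := by
    have hinj : Function.Injective fun k : ℕ => ((k + 1 : ℕ) : ℂ)⁻¹ := fun i j hij => by
      simpa using hij
    refine Polynomial.eq_of_infinite_eval_eq _ _ ((Set.infinite_range_of_injective hinj).mono ?_)
    rintro _ ⟨k, rfl⟩
    have hz : (((k + 1 : ℕ) : ℂ)⁻¹) ≠ 0 := inv_ne_zero (by exact_mod_cast k.succ_ne_zero)
    simp only [Set.mem_ofPred_eq]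
    rw [e₁ _ (by simpa using hz), e₂ _ (by simpa using hz)]
    simp only [Polynomial.eval_X, Polynomial.eval_one, Polynomial.eval_C, Polynomial.eval_zero,
      zero_mul, one_mul, hk (k + 1), div_inv_eq_mul,
      mul_comm f]
  have h₁' := (eval_zero_eq_of_X_sq_dvd_sub (d₁ (by omega))).2
  have h₂' := (eval_zero_eq_of_X_sq_dvd_sub (d₂ (by omega))).2
  have hm : (m + 2 : ℂ) ≠ 0 := by exact_mod_cast (m + 1).succ_ne_zero
  rw [h, h₂'] at h₁'
  simp [apply_ite Polynomial.derivative, apply_ite (Polynomial.eval (0 : ℂ))] at h₁'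
  tauto

end Equivariance

/-- Let `n ≥ 2`.  If an invertible affine map `φ(x,y) = (ax+by+c, dx+ey+f)` commutes
with the folding map `G_n`, then `φ` is the identity map.  That is, the affine
automorphism group of `G_n` is trivial for all `n ≥ 2`. -/
theorem Gmap_aut (n : ℕ) (hn : 2 ≤ n) (a b c d e f : ℂ) (hinv : a * e - b * d ≠ 0)
    (hcomm : (fun p : ℂ × ℂ => (a * p.1 + b * p.2 + c, d * p.1 + e * p.2 + f)) ∘ Gmap n
      = Gmap n ∘ (fun p : ℂ × ℂ => (a * p.1 + b * p.2 + c, d * p.1 + e * p.2 + f))) :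
    (fun p : ℂ × ℂ => (a * p.1 + b * p.2 + c, d * p.1 + e * p.2 + f)) = id := by
  obtain ⟨m, rfl⟩ := Nat.exists_eq_add_of_le' hn
  have hXY (x y : ℂ) := congrFun hcomm (x, y)
  simp only [Function.comp_apply, Gmap, Prod.mk.injEq] at hXY
  obtain rfl : b = 0 := XG_equivariant_coeff_eq_zero fun x y => (hXY x y).1
  simp only [zero_mul, add_zero] at hXY hinv ⊢
  obtain ⟨h1, h2, h3⟩ := XG_equivariant_coeff_relations fun x y => (hXY x y).1
  obtain ⟨h4, h5, h6⟩ := YG_equivariant_coeff_relations fun x y => (hXY x y).2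
  have ha : a ≠ 0 := by rintro rfl; simp at hinv
  have he : e ≠ 0 := by rintro rfl; simp at hinv
  have ha2 : e = a ^ 2 := mul_left_cancel₀ (pow_ne_zero m ha) (by linear_combination h1 - h2)
  have he2 : e ^ 2 = a ^ 3 := mul_left_cancel₀ (pow_ne_zero m he) (by linear_combination h5 - h4)
  obtain rfl : a = 1 := mul_left_cancel₀ (pow_ne_zero 3 ha) (by
    rw [ha2] at he2
    linear_combination he2)
  obtain rfl : e = 1 := by simpa using ha2
  have hd : d = 0 := by
    simp only [one_pow] at h6
    linear_combination -h6
  subst hd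
  have hm : (m + 2 : ℂ) ≠ 0 := by exact_mod_cast (m + 1).succ_ne_zero
  obtain rfl : c = 0 := by simpa [hm] using h3
  obtain rfl : f = 0 := eq_zero_of_XG_periodic (m := m) fun x y => by simpa using (hXY x y).1
  funext p
  simp
end

section
/- For all n ≥ 1, both X_n and Y_n have total degree at most n, and if X̄_n, Ȳ_n ∈ ℂ[X,Y,Z] denote their degree-n homogenizations (i.e., X̄_n(X,Y,Z) = Z^n·X_n(X/Z, Y/Z) and similarly for Ȳ_n), then the only common zero in ℂ³ of the three homogeneous polynomials X̄_n, Ȳ_n, Z^n is (0,0,0). Consequently the homogenized folding map B̄_n : ℙ² → ℙ², [X:Y:Z] ↦ [X̄_n : Ȳ_n : Z^n], is a morphism of degree n. -/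
open MvPolynomial

/-- The degree-`n` homogenization of a polynomial `p(x,y)` of total degree at most `n`:
`p̄(X,Y,Z) = Z^n · p(X/Z, Y/Z)`, obtained by padding each monomial `x^i y^j` of `p`
with `Z^{n−i−j}`. -/
noncomputable def homog (n : ℕ) (p : MvPolynomial (Fin 2) ℂ) : MvPolynomial (Fin 3) ℂ :=
  ∑ m ∈ p.support,
    C (coeff m p) * X 0 ^ (m 0) * X 1 ^ (m 1) * X 2 ^ (n - (m 0 + m 1))

/-- Restriction of a polynomial in two variables to the line through the origin in
direction `w`, as a univariate polynomial. -/
noncomputable def restrictLine (w : Fin 2 → ℂ) : MvPolynomial (Fin 2) ℂ →ₐ[ℂ] Polynomial ℂ :=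
  aeval fun i => Polynomial.C (w i) * Polynomial.X

theorem restrictLine_X (w : Fin 2 → ℂ) (i : Fin 2) :
    restrictLine w (X i) = Polynomial.C (w i) * Polynomial.X := by
  simp [restrictLine]

theorem coeff_restrictLine_of_lt (w : Fin 2 → ℂ) {p : MvPolynomial (Fin 2) ℂ} {m n : ℕ}
    (hp : p.totalDegree ≤ m) (hmn : m < n) : (restrictLine w p).coeff n = 0 := by
  apply Polynomial.coeff_eq_zero_of_natDegree_lt
  refine lt_of_le_of_lt (aeval_natDegree_le p hp _ (n := 1) fun i => ?_) (by omega)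
  simpa using Polynomial.natDegree_C_mul_X_pow_le (w i) 1

theorem eval_homog_of_eq_zero {p : MvPolynomial (Fin 2) ℂ} {n : ℕ} (hp : p.totalDegree ≤ n)
    {v : Fin 3 → ℂ} (hv : v 2 = 0) :
    eval v (homog n p) = (restrictLine ![v 0, v 1] p).coeff n := by
  rw [homog, map_sum, restrictLine, aeval_def, eval₂_eq', Polynomial.finsetSum_coeff]
  refine Finset.sum_congr rfl fun m hm => ?_
  have hle : m 0 + m 1 ≤ n := by
    have := (le_totalDegree hm).trans hp
    rwa [Finsupp.sum_fintype _ _ (fun _ => rfl), Fin.sum_univ_two] at this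
  have hterm : algebraMap ℂ (Polynomial ℂ) (coeff m p) *
      ∏ i, (Polynomial.C (![v 0, v 1] i) * Polynomial.X) ^ m i =
      Polynomial.C (coeff m p * v 0 ^ m 0 * v 1 ^ m 1) * Polynomial.X ^ (m 0 + m 1) := by
    simp only [Fin.prod_univ_two, Polynomial.algebraMap_eq, map_mul, map_pow, Matrix.cons_val_zero,
      Matrix.cons_val_one]
    ring
  rw [hterm, Polynomial.coeff_C_mul_X_pow]
  rcases hle.eq_or_lt with h | h
  · simp [h]
  · simp [hv, h.ne', Nat.sub_ne_zero_of_lt h]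

theorem totalDegree_mul_le {p q : MvPolynomial (Fin 2) ℂ} {a b n : ℕ} (hp : p.totalDegree ≤ a)
    (hq : q.totalDegree ≤ b) (h : a + b ≤ n) : (p * q).totalDegree ≤ n :=
  (totalDegree_mul p q).trans (by omega)

theorem totalDegree_add_le {p q : MvPolynomial (Fin 2) ℂ} {n : ℕ} (hp : p.totalDegree ≤ n)
    (hq : q.totalDegree ≤ n) : (p + q).totalDegree ≤ n :=
  (totalDegree_add p q).trans (max_le hp hq)

theorem totalDegree_sub_le {p q : MvPolynomial (Fin 2) ℂ} {n : ℕ} (hp : p.totalDegree ≤ n)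
    (hq : q.totalDegree ≤ n) : (p - q).totalDegree ≤ n :=
  (totalDegree_sub p q).trans (max_le hp hq)

theorem totalDegree_ofNat_le (k n : ℕ) [k.AtLeastTwo] :
    (ofNat(k) : MvPolynomial (Fin 2) ℂ).totalDegree ≤ n := by
  rw [← map_ofNat C, totalDegree_C]
  exact n.zero_le

theorem totalDegree_X_pow_le (i : Fin 2) {k n : ℕ} (h : k ≤ n) :
    (X i ^ k : MvPolynomial (Fin 2) ℂ).totalDegree ≤ n := by
  rwa [totalDegree_X_pow]

theorem totalDegree_X_le (i : Fin 2) {n : ℕ} (h : 1 ≤ n) :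
    (X i : MvPolynomial (Fin 2) ℂ).totalDegree ≤ n := by
  rwa [totalDegree_X]

theorem totalDegree_XB_le : ∀ n, (XB n).totalDegree ≤ n
  | 0 => totalDegree_ofNat_le 4 0
  | 1 => totalDegree_X_le 0 le_rfl
  | 2 => totalDegree_sub_le (totalDegree_sub_le (totalDegree_X_pow_le 0 le_rfl)
      (totalDegree_mul_le (totalDegree_ofNat_le 2 0) (totalDegree_X_le 1 le_rfl) (by omega)))
      (totalDegree_ofNat_le 4 2)
  | 3 => totalDegree_sub_le (totalDegree_sub_le (totalDegree_X_pow_le 0 le_rfl)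
      (totalDegree_mul_le (totalDegree_mul_le (totalDegree_ofNat_le 3 0)
        (totalDegree_X_le 0 le_rfl) le_rfl) (totalDegree_X_le 1 le_rfl) (by omega)))
      (totalDegree_mul_le (totalDegree_ofNat_le 3 0) (totalDegree_X_le 0 le_rfl) (by omega))
  | n + 4 => by
    have h0 := totalDegree_XB_le n
    have h1 := totalDegree_XB_le (n + 1)
    have h2 := totalDegree_XB_le (n + 2)
    have h3 := totalDegree_XB_le (n + 3)
    rw [XB]
    exact totalDegree_sub_le (totalDegree_sub_le
      (totalDegree_mul_le (totalDegree_X_le 0 le_rfl)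
        (totalDegree_add_le h3 (h1.trans (by omega))) (by omega))
      (totalDegree_mul_le (totalDegree_add_le (totalDegree_ofNat_le 2 1)
        (totalDegree_X_le 1 le_rfl)) h2 (by omega))) (h0.trans (by omega))

theorem totalDegree_YB_le : ∀ n, (YB n).totalDegree ≤ n
  | 0 => totalDegree_ofNat_le 4 0
  | 1 => totalDegree_X_le 1 le_rfl
  | 2 => totalDegree_add_le (totalDegree_add_le (totalDegree_sub_le
      (totalDegree_X_pow_le 1 le_rfl)
      (totalDegree_mul_le (totalDegree_ofNat_le 2 0) (totalDegree_X_pow_le 0 le_rfl) (by omega)))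
      (totalDegree_mul_le (totalDegree_ofNat_le 4 0) (totalDegree_X_le 1 le_rfl) (by omega)))
      (totalDegree_ofNat_le 4 2)
  | 3 => totalDegree_add_le (totalDegree_add_le (totalDegree_sub_le
      (totalDegree_X_pow_le 1 le_rfl)
      (totalDegree_mul_le (totalDegree_mul_le (totalDegree_ofNat_le 3 0)
        (totalDegree_X_pow_le 0 le_rfl) le_rfl) (totalDegree_X_le 1 le_rfl) (by omega)))
      (totalDegree_mul_le (totalDegree_ofNat_le 6 0) (totalDegree_X_pow_le 1 le_rfl) (by omega)))
      (totalDegree_mul_le (totalDegree_ofNat_le 9 0) (totalDegree_X_le 1 le_rfl) (by omega))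
  | n + 4 => by
    have h0 := totalDegree_YB_le n
    have h1 := totalDegree_YB_le (n + 1)
    have h2 := totalDegree_YB_le (n + 2)
    have h3 := totalDegree_YB_le (n + 3)
    rw [YB]
    exact totalDegree_sub_le (totalDegree_sub_le
      (totalDegree_mul_le (totalDegree_X_le 1 le_rfl)
        (totalDegree_add_le h3 (h1.trans (by omega))) (by omega))
      (totalDegree_mul_le (totalDegree_sub_le (totalDegree_sub_le (totalDegree_X_pow_le 0 le_rfl)
        (totalDegree_mul_le (totalDegree_ofNat_le 2 0) (totalDegree_X_le 1 le_rfl) (by omega)))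
        (totalDegree_ofNat_le 2 2)) h2 (by omega))) (h0.trans (by omega))

theorem coeff_restrictLine_X_mul (w : Fin 2 → ℂ) (i : Fin 2) (p : MvPolynomial (Fin 2) ℂ)
    (n : ℕ) : (restrictLine w (X i * p)).coeff (n + 1) = w i * (restrictLine w p).coeff n := by
  rw [map_mul, restrictLine_X, mul_assoc, Polynomial.coeff_C_mul, Polynomial.coeff_X_mul]

theorem coeff_restrictLine_X_pow (w : Fin 2 → ℂ) (i : Fin 2) (n : ℕ) :
    (restrictLine w (X i ^ n)).coeff n = w i ^ n := by
  rw [map_pow, restrictLine_X, mul_pow, ← map_pow, Polynomial.coeff_C_mul_X_pow, if_pos rfl]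

/-- The top-degree form of `X_n` is `x ^ n`. -/
theorem coeff_restrictLine_XB (w : Fin 2 → ℂ) :
    ∀ n, (restrictLine w (XB (n + 1))).coeff (n + 1) = w 0 ^ (n + 1)
  | 0 => by simp [XB, restrictLine_X]
  | 1 => by
    have h : (restrictLine w (2 * X 1 + 4)).coeff 2 = 0 :=
      coeff_restrictLine_of_lt w (m := 1) (totalDegree_add_le (totalDegree_mul_le
        (totalDegree_ofNat_le 2 0) (totalDegree_X_le 1 le_rfl) le_rfl)
        (totalDegree_ofNat_le 4 1)) (by omega)
    have e : XB 2 = X 0 ^ 2 - (2 * X 1 + 4) := by rw [XB]; ring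
    rw [e, map_sub, Polynomial.coeff_sub, h, coeff_restrictLine_X_pow]
    simp
  | 2 => by
    have h : (restrictLine w (3 * X 0 * X 1 + 3 * X 0)).coeff 3 = 0 :=
      coeff_restrictLine_of_lt w (m := 2) (totalDegree_add_le (totalDegree_mul_le
        (totalDegree_mul_le (totalDegree_ofNat_le 3 0) (totalDegree_X_le 0 le_rfl) le_rfl)
        (totalDegree_X_le 1 le_rfl) le_rfl) (totalDegree_mul_le (totalDegree_ofNat_le 3 0)
        (totalDegree_X_le 0 le_rfl) (by omega))) (by omega)
    have e : XB 3 = X 0 ^ 3 - (3 * X 0 * X 1 + 3 * X 0) := by rw [XB]; ring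
    rw [e, map_sub, Polynomial.coeff_sub, h, coeff_restrictLine_X_pow]
    simp
  | n + 3 => by
    have h1 := coeff_restrictLine_of_lt w (totalDegree_XB_le (n + 1)) (n := n + 3) (by omega)
    have h2 : (restrictLine w ((2 + X 1) * XB (n + 2) + XB n)).coeff (n + 4) = 0 :=
      coeff_restrictLine_of_lt w (m := n + 3) (totalDegree_add_le
        (totalDegree_mul_le (totalDegree_add_le (totalDegree_ofNat_le 2 1)
        (totalDegree_X_le 1 le_rfl)) (totalDegree_XB_le (n + 2)) (by omega))
        ((totalDegree_XB_le n).trans (by omega))) (by omega)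
    rw [XB, sub_sub, map_sub, Polynomial.coeff_sub, h2, coeff_restrictLine_X_mul, map_add,
      Polynomial.coeff_add, h1, coeff_restrictLine_XB w (n + 2)]
    ring

/-- The top-degree form of `Y_n` is `y ^ n` along the line `x = 0`. -/
theorem coeff_restrictLine_YB {w : Fin 2 → ℂ} (hw : w 0 = 0) :
    ∀ n, (restrictLine w (YB (n + 1))).coeff (n + 1) = w 1 ^ (n + 1)
  | 0 => by simp [YB, restrictLine_X]
  | 1 => by
    have h : (restrictLine w (4 * X 1 + 4)).coeff 2 = 0 :=
      coeff_restrictLine_of_lt w (m := 1) (totalDegree_add_le (totalDegree_mul_le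
        (totalDegree_ofNat_le 4 0) (totalDegree_X_le 1 le_rfl) le_rfl)
        (totalDegree_ofNat_le 4 1)) (by omega)
    have e : YB 2 = X 1 ^ 2 - X 0 * (2 * X 0) + (4 * X 1 + 4) := by rw [YB]; ring
    rw [e, map_add, map_sub, Polynomial.coeff_add, Polynomial.coeff_sub, h,
      coeff_restrictLine_X_mul, hw, coeff_restrictLine_X_pow]
    simp
  | 2 => by
    have h : (restrictLine w (6 * X 1 ^ 2 + 9 * X 1)).coeff 3 = 0 :=
      coeff_restrictLine_of_lt w (m := 2) (totalDegree_add_le (totalDegree_mul_le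
        (totalDegree_ofNat_le 6 0) (totalDegree_X_pow_le 1 le_rfl) le_rfl)
        (totalDegree_mul_le (totalDegree_ofNat_le 9 0)
        (totalDegree_X_le 1 le_rfl) (by omega))) (by omega)
    have e : YB 3 = X 1 ^ 3 - X 0 * (3 * X 0 * X 1) + (6 * X 1 ^ 2 + 9 * X 1) := by rw [YB]; ring
    rw [e, map_add, map_sub, Polynomial.coeff_add, Polynomial.coeff_sub, h,
      coeff_restrictLine_X_mul, hw, coeff_restrictLine_X_pow]
    simp
  | n + 3 => by
    have h1 := coeff_restrictLine_of_lt w (totalDegree_YB_le (n + 1)) (n := n + 3) (by omega)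
    have h2 : (restrictLine w ((2 + 2 * X 1) * YB (n + 2) - YB n)).coeff (n + 4) = 0 :=
      coeff_restrictLine_of_lt w (m := n + 3) (totalDegree_sub_le
        (totalDegree_mul_le (totalDegree_add_le (totalDegree_ofNat_le 2 1)
        (totalDegree_mul_le (totalDegree_ofNat_le 2 0) (totalDegree_X_le 1 le_rfl) le_rfl))
        (totalDegree_YB_le (n + 2)) (by omega))
        ((totalDegree_YB_le n).trans (by omega))) (by omega)
    have e : YB (n + 4) = X 1 * (YB (n + 3) + YB (n + 1)) - X 0 * (X 0 * YB (n + 2)) +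
        ((2 + 2 * X 1) * YB (n + 2) - YB n) := by rw [YB]; ring
    rw [e, map_add, map_sub, Polynomial.coeff_add, Polynomial.coeff_sub, h2,
      coeff_restrictLine_X_mul, coeff_restrictLine_X_mul, hw, map_add,
      Polynomial.coeff_add, h1, coeff_restrictLine_YB hw (n + 2)]
    ring

/-- For `n ≥ 1`, the coordinates `X_n, Y_n` of the folding map `B_n = 𝖥_n[𝓑₂]` have
total degree at most `n`, and the only common zero in `ℂ³` of the degree-`n`
homogenizations `X̄_n, Ȳ_n` together with `Z^n` is `(0,0,0)`.  Consequently the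
homogenized folding map `B̄_n = [X̄_n : Ȳ_n : Z^n] : ℙ² → ℙ²` is a morphism of
degree `n`. -/
theorem Bbar_is_morphism (n : ℕ) (hn : 1 ≤ n) :
    (XB n).totalDegree ≤ n ∧ (YB n).totalDegree ≤ n ∧
    ∀ v : Fin 3 → ℂ,
      eval v (homog n (XB n)) = 0 →
      eval v (homog n (YB n)) = 0 →
      v 2 ^ n = 0 →
      v = 0 := by
  refine ⟨totalDegree_XB_le n, totalDegree_YB_le n, fun v hX hY hZ => ?_⟩
  obtain ⟨k, rfl⟩ := Nat.exists_eq_add_of_le' hn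
  have h2 : v 2 = 0 := eq_zero_of_pow_eq_zero hZ
  rw [eval_homog_of_eq_zero (totalDegree_XB_le _) h2, coeff_restrictLine_XB] at hX
  have h0 : v 0 = 0 := eq_zero_of_pow_eq_zero hX
  rw [eval_homog_of_eq_zero (totalDegree_YB_le _) h2, coeff_restrictLine_YB h0] at hY
  have h1 : v 1 = 0 := eq_zero_of_pow_eq_zero hY
  ext i
  fin_cases i
  exacts [h0, h1, h2]
end

section
/- Let n ≥ 2 and set d = ⌊3n/2⌋. Let X̄_n ∈ ℂ[X,Y,Z] be the degree-n homogenization of X_n and Ȳ_n the degree-d homogenization of Y_n, and consider the three homogeneous degree-d polynomials Z^{d−n}·X̄_n, Ȳ_n, Z^d defining the rational map Ḡ_n : ℙ² ⇢ ℙ². Then the set of common zeros of these three polynomials in ℙ²(ℂ) (the indeterminacy locus of Ḡ_n) equals {[0:1:0]} if n is even, and equals {[0:1:0], [1:0:0]} if n is odd. In particular, for n ≥ 2 the map Ḡ_n is not a morphism of ℙ². -/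
open MvPolynomial

set_option maxHeartbeats 1000000

/-- The homomorphism `x ↦ x·T`, `y ↦ y·T`, whose `T^k`-coefficient is the homogeneous component
of degree `k`. -/
noncomputable def gradeHom :
    MvPolynomial (Fin 2) ℂ →ₐ[ℂ] Polynomial (MvPolynomial (Fin 2) ℂ) :=
  aeval fun i => Polynomial.C (X i) * Polynomial.X

/-- `p` has total degree at most `d`, and its homogeneous component of degree `d` is `q`. -/
def HasTop (d : ℕ) (p q : MvPolynomial (Fin 2) ℂ) : Prop :=
  (gradeHom p).natDegree ≤ d ∧ (gradeHom p).coeff d = q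

namespace HasTop

variable {d e : ℕ} {p p' q q' : MvPolynomial (Fin 2) ℂ}

lemma add (h : HasTop d p q) (h' : HasTop d p' q') : HasTop d (p + p') (q + q') := by
  refine ⟨?_, by rw [map_add, Polynomial.coeff_add, h.2, h'.2]⟩
  rw [map_add]
  exact Polynomial.natDegree_add_le_of_degree_le h.1 h'.1

lemma neg (h : HasTop d p q) : HasTop d (-p) (-q) := by
  refine ⟨?_, by rw [map_neg, Polynomial.coeff_neg, h.2]⟩
  rw [map_neg, Polynomial.natDegree_neg]
  exact h.1

lemma sub (h : HasTop d p q) (h' : HasTop d p' q') : HasTop d (p - p') (q - q') := by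
  rw [sub_eq_add_neg, sub_eq_add_neg]
  exact h.add h'.neg

lemma mul (h : HasTop d p q) (h' : HasTop e p' q') : HasTop (d + e) (p * p') (q * q') := by
  refine ⟨?_, ?_⟩
  · rw [map_mul]
    exact Polynomial.natDegree_mul_le_of_le h.1 h'.1
  · rw [map_mul, Polynomial.coeff_mul_add_eq_of_natDegree_le h.1 h'.1, h.2, h'.2]

lemma lift (h : HasTop d p q) (hde : d < e) : HasTop e p 0 :=
  ⟨h.1.trans hde.le, Polynomial.coeff_eq_zero_of_natDegree_lt (h.1.trans_lt hde)⟩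

lemma congr (h : HasTop d p q) (hde : d = e) (hq : q = q') : HasTop e p q' := by
  subst hde hq
  exact h

end HasTop

lemma gradeHom_monomial (m : Fin 2 →₀ ℕ) (a : ℂ) :
    gradeHom (monomial m a) = Polynomial.monomial (m 0 + m 1) (monomial m a) := by
  rw [gradeHom, aeval_monomial, Finsupp.prod_fintype _ _ (by simp), Fin.prod_univ_two,
    monomial_eq, Finsupp.prod_fintype _ _ (by simp), Fin.prod_univ_two,
    ← Polynomial.C_mul_X_pow_eq_monomial]
  simp only [Polynomial.C_mul, Polynomial.C_pow, mul_pow, pow_add]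
  change Polynomial.C (C a) * _ = _
  ring

lemma coeff_coeff_gradeHom (p : MvPolynomial (Fin 2) ℂ) (k : ℕ) (m : Fin 2 →₀ ℕ) :
    coeff m ((gradeHom p).coeff k) = if m 0 + m 1 = k then coeff m p else 0 := by
  induction p using MvPolynomial.induction_on' with
  | monomial u a =>
    rw [gradeHom_monomial, Polynomial.coeff_monomial]
    by_cases hum : u = m
    · subst hum
      split_ifs <;> simp
    · split_ifs <;> simp [coeff_monomial, hum]
  | add p q hp hq =>
    rw [map_add, Polynomial.coeff_add, coeff_add, hp, hq, coeff_add]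
    split_ifs <;> simp

lemma HasTop.add_le {d : ℕ} {p q : MvPolynomial (Fin 2) ℂ} (h : HasTop d p q)
    {m : Fin 2 →₀ ℕ} (hm : m ∈ p.support) : m 0 + m 1 ≤ d := by
  by_contra! hlt
  have hc := coeff_coeff_gradeHom p (m 0 + m 1) m
  rw [Polynomial.coeff_eq_zero_of_natDegree_lt (h.1.trans_lt hlt), if_pos rfl, coeff_zero] at hc
  exact mem_support_iff.mp hm hc.symm

lemma HasTop.eval_homog {d : ℕ} {p q : MvPolynomial (Fin 2) ℂ} (h : HasTop d p q)
    {v : Fin 3 → ℂ} (hv : v 2 = 0) : eval v (homog d p) = eval ![v 0, v 1] q := by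
  have hsub : q.support ⊆ p.support := by
    intro m hm
    rw [mem_support_iff, ← h.2, coeff_coeff_gradeHom] at hm
    rw [mem_support_iff]
    exact fun h0 => hm (by simp [h0])
  rw [homog, map_sum, eval_eq', Finset.sum_subset hsub fun m _ hm => by
    rw [notMem_support_iff.mp hm, zero_mul]]
  refine Finset.sum_congr rfl fun m hm => ?_
  rw [← h.2, coeff_coeff_gradeHom]
  have hle := h.add_le hm
  split_ifs with hd
  · simp [Fin.prod_univ_two, hd, mul_assoc]
  · have : d - (m 0 + m 1) ≠ 0 := by omega
    simp [hv, this]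

lemma gradeHom_X (i : Fin 2) : gradeHom (X i) = Polynomial.C (X i) * Polynomial.X :=
  aeval_X _ _

lemma hasTop_X (i : Fin 2) : HasTop 1 (X i) (X i) := by
  constructor <;> rw [gradeHom_X]
  · compute_degree
  · compute_degree!

lemma hasTop_cubic : HasTop 3 (X 0 ^ 3 - 3 * X 0 * X 1 - 9 * X 0 - 5 * X 1 - 9) (X 0 ^ 3) := by
  constructor <;>
    simp only [map_sub, map_mul, map_pow, map_ofNat, gradeHom_X]
  · compute_degree
  · compute_degree!

lemma hasTop_middle : HasTop 3
    (X 1 ^ 2 - 2 * X 0 ^ 3 + 6 * X 0 * X 1 + 18 * X 0 + 12 * X 1 + 8) (-2 * X 0 ^ 3) := by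
  constructor <;>
    simp only [map_sub, map_add, map_mul, map_pow, map_ofNat, gradeHom_X]
  · compute_degree
  · compute_degree!

lemma hasTop_YG_zero : HasTop 0 (YG 0) 6 := by
  constructor <;> rw [YG, map_ofNat]
  · compute_degree
  · compute_degree!

lemma hasTop_YG_two : HasTop 3 (YG 2) (-2 * X 0 ^ 3) := by
  constructor <;>
    simp only [YG, map_add, map_neg, map_mul, map_pow, map_ofNat, gradeHom_X]
  · compute_degree
  · compute_degree!

lemma hasTop_YG_three : HasTop 4 (YG 3) (-3 * X 0 ^ 3 * X 1) := by
  constructor <;>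
    simp only [YG, map_sub, map_add, map_neg, map_mul, map_pow, map_ofNat, gradeHom_X]
  · compute_degree
  · compute_degree!

lemma hasTop_YG_four : HasTop 6 (YG 4) (2 * X 0 ^ 6) := by
  constructor <;>
    simp only [YG, map_sub, map_add, map_mul, map_pow, map_ofNat, gradeHom_X]
  · compute_degree
  · compute_degree!

lemma hasTop_YG_five : HasTop 7 (YG 5) (5 * X 0 ^ 6 * X 1) := by
  constructor <;>
    simp only [YG, map_sub, map_add, map_mul, map_pow, map_ofNat, gradeHom_X]
  · compute_degree
  · compute_degree!

/-- The leading forms of `YG (2 * k)` and `YG (2 * k + 1)`; the constant `YG 0 = 6` is the only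
exception to the pattern `2 * (-1) ^ k * x ^ (3 * k)`. -/
lemma hasTop_YG (k : ℕ) :
    HasTop (3 * k) (YG (2 * k)) ((if k = 0 then 6 else 2 * (-1) ^ k) * X 0 ^ (3 * k)) ∧
      HasTop (3 * k + 1) (YG (2 * k + 1)) ((2 * (k : MvPolynomial (Fin 2) ℂ) + 1) * (-1) ^ k *
        X 0 ^ (3 * k) * X 1) := by
  induction k using Nat.strong_induction_on with
  | _ k ih =>
    match k with
    | 0 => exact ⟨hasTop_YG_zero.congr rfl (by simp), (hasTop_X 1).congr rfl (by simp)⟩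
    | 1 =>
      exact ⟨hasTop_YG_two.congr rfl (by simp),
        hasTop_YG_three.congr rfl (by push_cast; ring)⟩
    | 2 =>
      exact ⟨hasTop_YG_four.congr rfl (by simp),
        hasTop_YG_five.congr rfl (by push_cast; ring)⟩
    | k + 3 =>
      obtain ⟨h0, h1⟩ := ih k (by omega)
      obtain ⟨h2, h3⟩ := ih (k + 1) (by omega)
      obtain ⟨h4, h5⟩ := ih (k + 2) (by omega)
      rw [if_neg (by omega)] at h4
      have h6 : HasTop (3 * (k + 3)) (YG (2 * (k + 3)))
          (2 * (-1) ^ (k + 3) * X 0 ^ (3 * (k + 3))) := by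
        change HasTop _ (YG (2 * k + 6)) _
        rw [YG]
        refine ((((hasTop_X 1).mul (h5.add (h1.lift (by omega)))).lift (by omega)).sub
          ((hasTop_cubic.mul (h4.add (h2.lift (by omega)))).congr (by omega) rfl) |>.add
          ((hasTop_middle.mul h3).lift (by omega)) |>.sub (h0.lift (by omega))).congr rfl ?_
        ring
      refine ⟨by rwa [if_neg (by omega)], ?_⟩
      change HasTop _ (YG (2 * k + 1 + 6)) _
      rw [YG]
      refine ((((hasTop_X 1).mul (h6.add (h2.lift (by omega)))).congr (by omega) rfl).sub
        ((hasTop_cubic.mul (h5.add (h3.lift (by omega)))).congr (by omega) rfl) |>.add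
        ((hasTop_middle.mul h4).lift (by omega)) |>.sub (h1.lift (by omega))).congr rfl ?_
      push_cast
      ring

/-- Let `n ≥ 2` and `d = ⌊3n/2⌋`.  The indeterminacy locus of the rational map
`Ḡ_n : ℙ² ⇢ ℙ²` defined by the three homogeneous degree-`d` polynomials
`Z^{d−n}·X̄_n`, `Ȳ_n`, `Z^d` (where `X̄_n` is the degree-`n` homogenization of `X_n`
and `Ȳ_n` the degree-`d` homogenization of `Y_n`) equals `{[0:1:0]}` if `n` is even
and `{[0:1:0], [1:0:0]}` if `n` is odd: a nonzero `v = (v₀,v₁,v₂) ∈ ℂ³` is a common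
zero of the three polynomials if and only if `v₀ = v₂ = 0` (the point `[0:1:0]`), or
`n` is odd and `v₁ = v₂ = 0` (the point `[1:0:0]`).  In particular, for `n ≥ 2` the
map `Ḡ_n` is not a morphism of `ℙ²`. -/
theorem Gbar_indeterminacy (n : ℕ) (hn : 2 ≤ n) (v : Fin 3 → ℂ) (hv : v ≠ 0) :
    (eval v (X 2 ^ (3 * n / 2 - n) * homog n (XG n)) = 0 ∧
        eval v (homog (3 * n / 2) (YG n)) = 0 ∧
        eval v ((X 2 : MvPolynomial (Fin 3) ℂ) ^ (3 * n / 2)) = 0)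
      ↔ ((v 0 = 0 ∧ v 2 = 0) ∨ (Odd n ∧ v 1 = 0 ∧ v 2 = 0)) := by
  have hd : 3 * n / 2 ≠ 0 := by omega
  have hdn : 3 * n / 2 - n ≠ 0 := by omega
  simp only [map_mul, map_pow, eval_X, pow_eq_zero_iff hd, mul_eq_zero, pow_eq_zero_iff hdn]
  by_cases h2 : v 2 = 0
  swap
  · simp [h2]
  simp only [h2, true_or, true_and, and_true]
  obtain ⟨k, rfl | rfl⟩ := n.even_or_odd'
  · have hk : k ≠ 0 := by omega
    have heq : 3 * (2 * k) / 2 = 3 * k := by omega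
    rw [heq, (hasTop_YG k).1.eval_homog h2]
    simp [hk]
  · have hk : k ≠ 0 := by omega
    have heq : 3 * (2 * k + 1) / 2 = 3 * k + 1 := by omega
    have hne : (2 * k + 1 : ℂ) ≠ 0 := by exact_mod_cast (2 * k).succ_ne_zero
    rw [heq, (hasTop_YG k).2.eval_homog h2]
    simp [hk, hne]
end
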